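/- Let F_C be an inhomogeneous self-similar set in ℝ^n. Then max{ upper box dimension of F_∅, upper box dimension of C } ≤ upper box dimension of F_C ≤ max{ s*, upper box dimension of C }, where s* is the modified similarity dimension. -/

import Mathlib

/-- The number of cubes from the `δ`-mesh on `ℝ^d` (products of half-open intervals
`[aδ, (a+1)δ)`, `a ∈ ℤ`) that intersect `E`. -/
noncomputable def meshCount (d : ℕ) (δ : ℝ) (E : Set (Fin d → ℝ)) : ℕ :=
  Set.ncard {a : Fin d → ℤ | ∃ x ∈ E, ∀ i, (a i : ℝ) * δ ≤ x i ∧ x i < ((a i : ℝ) + 1) * δ}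

/-- The upper box dimension of `E ⊆ ℝ^d`. -/
noncomputable def upperBoxDim (d : ℕ) (E : Set (Fin d → ℝ)) : ℝ :=
  Filter.limsup (fun δ : ℝ => Real.log (meshCount d δ E) / (-Real.log δ))
    (nhdsWithin 0 (Set.Ioi 0))

/-- The Euclidean distance on `ℝ^d` (realised as `Fin d → ℝ`). -/
noncomputable def euclDist (d : ℕ) (x y : Fin d → ℝ) : ℝ :=
  Real.sqrt (∑ i, (x i - y i) ^ 2)

/-- The composition `S_I = S_{i₁} ∘ ⋯ ∘ S_{i_k}` along a finite word `I`. -/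
def wordS {m : ℕ} {X : Type*} (S : Fin m → X → X) (I : List (Fin m)) : X → X :=
  I.foldr (fun i f => S i ∘ f) id

/-- The contraction ratio `c_I = c_{i₁} ⋯ c_{i_k}` of a finite word `I`. -/
def wordC {m : ℕ} (c : Fin m → ℝ) (I : List (Fin m)) : ℝ := (I.map c).prod

/-- `I(r)`: the set of finite words `I` with `c_I ≤ r < c_{I†}`, where `I†` is `I` with
its last letter removed (the empty word corresponding to the identity, with ratio `1`). -/
def stopWords {m : ℕ} (c : Fin m → ℝ) (r : ℝ) : Set (List (Fin m)) :=
  {I | I ≠ [] ∧ wordC c I ≤ r ∧ r < wordC c I.dropLast}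

open Filter Topology

section Mesh

variable {d : ℕ}

/-- The index of the `δ`-mesh cube that contains `x`. -/
noncomputable def meshIndex (δ : ℝ) (x : Fin d → ℝ) : Fin d → ℤ := fun i => ⌊x i / δ⌋

theorem meshCount_eq_ncard_image {δ : ℝ} (hδ : 0 < δ) (E : Set (Fin d → ℝ)) :
    meshCount d δ E = (meshIndex δ '' E).ncard := by
  unfold meshCount
  congr 1
  ext a
  simp only [Set.mem_ofPred_eq, Set.mem_image]
  refine exists_congr fun x => and_congr_right fun _ => ?_
  rw [funext_iff]
  refine forall_congr' fun i => ?_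
  rw [meshIndex, Int.floor_eq_iff, le_div_iff₀ hδ, div_lt_iff₀ hδ]

theorem finite_meshIndex_image_and_ncard_le {δ ρ : ℝ} (hδ : 0 < δ) (hρ : 0 ≤ ρ) (y : Fin d → ℝ)
    {E : Set (Fin d → ℝ)} (hE : ∀ x ∈ E, ∀ i, |x i - y i| ≤ ρ) :
    (meshIndex δ '' E).Finite ∧ ((meshIndex δ '' E).ncard : ℝ) ≤ (2 * ρ / δ + 2) ^ d := by
  set T : Finset (Fin d → ℤ) :=
    Fintype.piFinset fun i => Finset.Icc ⌊(y i - ρ) / δ⌋ ⌊(y i + ρ) / δ⌋ with hT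
  have hsub : meshIndex δ '' E ⊆ (T : Set (Fin d → ℤ)) := by
    rintro _ ⟨x, hx, rfl⟩
    rw [Finset.mem_coe, hT, Fintype.mem_piFinset]
    intro i
    have h := abs_le.1 (hE x hx i)
    rw [Finset.mem_Icc]
    constructor <;> apply Int.floor_le_floor <;> gcongr <;> linarith
  refine ⟨T.finite_toSet.subset hsub, ?_⟩
  have hle : (meshIndex δ '' E).ncard ≤ T.card := by
    simpa using Set.ncard_le_ncard hsub T.finite_toSet
  refine (Nat.cast_le.2 hle).trans ?_
  rw [hT, Fintype.card_piFinset, Nat.cast_prod]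
  refine (Finset.prod_le_prod (g := fun _ => 2 * ρ / δ + 2) (fun i _ => Nat.cast_nonneg _)
    fun i _ => ?_).trans_eq (by simp)
  have hmono : ⌊(y i - ρ) / δ⌋ ≤ ⌊(y i + ρ) / δ⌋ + 1 := by
    have : ⌊(y i - ρ) / δ⌋ ≤ ⌊(y i + ρ) / δ⌋ := by
      apply Int.floor_le_floor
      gcongr
      linarith
    linarith
  rw [Int.card_Icc, ← Int.cast_natCast, Int.toNat_of_nonneg (by linarith)]
  push_cast
  have h1 := Int.floor_le ((y i + ρ) / δ)
  have h2 := Int.lt_floor_add_one ((y i - ρ) / δ)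
  have h3 : (y i + ρ) / δ - (y i - ρ) / δ = 2 * ρ / δ := by ring
  linarith

theorem exists_abs_le_of_isBounded {E : Set (Fin d → ℝ)} (hE : Bornology.IsBounded E) :
    ∃ ρ : ℝ, 0 ≤ ρ ∧ ∀ x ∈ E, ∀ i, |x i| ≤ ρ := by
  obtain ⟨ρ, hρ, h⟩ := hE.exists_pos_norm_le
  exact ⟨ρ, hρ.le, fun x hx i => (norm_le_pi_norm x i).trans (h x hx)⟩

theorem finite_meshIndex_image {δ : ℝ} (hδ : 0 < δ) {E : Set (Fin d → ℝ)}
    (hE : Bornology.IsBounded E) : (meshIndex δ '' E).Finite := by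
  obtain ⟨ρ, hρ, h⟩ := exists_abs_le_of_isBounded hE
  exact (finite_meshIndex_image_and_ncard_le hδ hρ 0 (by simpa using h)).1

theorem meshCount_mono {δ : ℝ} (hδ : 0 < δ) {E E' : Set (Fin d → ℝ)} (h : E ⊆ E')
    (hE' : Bornology.IsBounded E') : meshCount d δ E ≤ meshCount d δ E' := by
  rw [meshCount_eq_ncard_image hδ, meshCount_eq_ncard_image hδ]
  exact Set.ncard_le_ncard (Set.image_mono h) (finite_meshIndex_image hδ hE')

/-- Every bounded subset of `ℝ^d` meets `O(δ^{-d})` mesh cubes. -/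
theorem exists_meshCount_le_of_isBounded {E : Set (Fin d → ℝ)} (hE : Bornology.IsBounded E) :
    ∃ K : ℝ, 0 < K ∧
      ∀ δ ∈ Set.Ioc (0 : ℝ) 1, (meshCount d δ E : ℝ) ≤ K * δ ^ (-(d : ℝ)) := by
  obtain ⟨ρ, hρ, h⟩ := exists_abs_le_of_isBounded hE
  refine ⟨(2 * ρ + 2) ^ d, by positivity, fun δ hδ => ?_⟩
  have hδ0 : 0 < δ := hδ.1
  rw [meshCount_eq_ncard_image hδ0]
  refine (finite_meshIndex_image_and_ncard_le hδ0 hρ 0 (by simpa using h)).2.trans ?_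
  rw [Real.rpow_neg hδ0.le, Real.rpow_natCast, ← div_eq_mul_inv, ← div_pow]
  gcongr
  rw [le_div_iff₀ hδ0, add_mul, div_mul_cancel₀ _ hδ0.ne']
  linarith [hδ.2]

end Mesh

section UpperBoxDim

variable {d : ℕ}

theorem eventually_mem_Ioo_nhdsGT {ε : ℝ} (hε : 0 < ε) :
    ∀ᶠ δ in 𝓝[>] (0 : ℝ), δ ∈ Set.Ioo 0 ε := Ioo_mem_nhdsGT hε

theorem eventually_log_meshCount_div_nonneg (E : Set (Fin d → ℝ)) :
    ∀ᶠ δ in 𝓝[>] (0 : ℝ), 0 ≤ Real.log (meshCount d δ E) / (-Real.log δ) := by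
  filter_upwards [eventually_mem_Ioo_nhdsGT one_pos] with δ hδ
  exact div_nonneg (Real.log_natCast_nonneg _) (neg_nonneg.2 (Real.log_nonpos hδ.1.le hδ.2.le))

theorem isCoboundedUnder_log_meshCount_div (E : Set (Fin d → ℝ)) :
    IsCoboundedUnder (· ≤ ·) (𝓝[>] (0 : ℝ))
      fun δ => Real.log (meshCount d δ E) / (-Real.log δ) :=
  IsBoundedUnder.isCoboundedUnder_le ⟨0, eventually_map.2 (eventually_log_meshCount_div_nonneg E)⟩

theorem eventually_log_meshCount_div_le {E : Set (Fin d → ℝ)} {K t : ℝ} (hK : 1 ≤ K) (ht : 0 ≤ t)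
    (h : ∀ δ ∈ Set.Ioc (0 : ℝ) 1, (meshCount d δ E : ℝ) ≤ K * δ ^ (-t)) :
    ∀ᶠ δ in 𝓝[>] (0 : ℝ),
      Real.log (meshCount d δ E) / (-Real.log δ) ≤ Real.log K / (-Real.log δ) + t := by
  filter_upwards [eventually_mem_Ioo_nhdsGT one_pos] with δ hδ
  have hlog : 0 < -Real.log δ := neg_pos.2 (Real.log_neg hδ.1 hδ.2)
  rw [div_add' _ _ _ hlog.ne']
  gcongr
  have hpos : 0 < δ ^ (-t) := Real.rpow_pos_of_pos hδ.1 _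
  have hrhs : Real.log (K * δ ^ (-t)) = Real.log K + t * -Real.log δ := by
    rw [Real.log_mul (by positivity) hpos.ne', Real.log_rpow hδ.1]
    ring
  rw [← hrhs]
  rcases Nat.eq_zero_or_pos (meshCount d δ E) with h0 | h0
  · rw [h0, Nat.cast_zero, Real.log_zero, hrhs]
    have := Real.log_nonneg hK
    positivity
  · exact Real.log_le_log (by exact_mod_cast h0) (h δ ⟨hδ.1, hδ.2.le⟩)

theorem tendsto_div_neg_log_add (a t : ℝ) :
    Tendsto (fun δ : ℝ => a / (-Real.log δ) + t) (𝓝[>] 0) (𝓝 t) := by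
  have h : Tendsto (fun δ : ℝ => -Real.log δ) (𝓝[>] 0) atTop :=
    tendsto_neg_atBot_atTop.comp Real.tendsto_log_nhdsGT_zero
  simpa using (h.const_div_atTop a).add_const t

theorem upperBoxDim_le_of_meshCount_le {E : Set (Fin d → ℝ)} {K t : ℝ} (hK : 1 ≤ K) (ht : 0 ≤ t)
    (h : ∀ δ ∈ Set.Ioc (0 : ℝ) 1, (meshCount d δ E : ℝ) ≤ K * δ ^ (-t)) :
    upperBoxDim d E ≤ t := by
  have hlim := tendsto_div_neg_log_add (Real.log K) t
  rw [← hlim.limsup_eq]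
  exact limsup_le_limsup (eventually_log_meshCount_div_le hK ht h)
    (isCoboundedUnder_log_meshCount_div E) hlim.isBoundedUnder_le

theorem isBoundedUnder_log_meshCount_div {E : Set (Fin d → ℝ)} (hE : Bornology.IsBounded E) :
    IsBoundedUnder (· ≤ ·) (𝓝[>] (0 : ℝ))
      fun δ => Real.log (meshCount d δ E) / (-Real.log δ) := by
  obtain ⟨K, -, h⟩ := exists_meshCount_le_of_isBounded hE
  refine (tendsto_div_neg_log_add (Real.log (max K 1)) d).isBoundedUnder_le.mono_le
    (eventually_log_meshCount_div_le (le_max_right _ _) d.cast_nonneg fun δ hδ => ?_)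
  refine (h δ hδ).trans ?_
  have := Real.rpow_nonneg hδ.1.le (-(d : ℝ))
  gcongr
  exact le_max_left _ _

theorem upperBoxDim_mono {E E' : Set (Fin d → ℝ)} (h : E ⊆ E') (hE' : Bornology.IsBounded E') :
    upperBoxDim d E ≤ upperBoxDim d E' := by
  refine limsup_le_limsup ?_ (isCoboundedUnder_log_meshCount_div E)
    (isBoundedUnder_log_meshCount_div hE')
  filter_upwards [eventually_mem_Ioo_nhdsGT one_pos] with δ hδ
  have hlog : 0 < -Real.log δ := neg_pos.2 (Real.log_neg hδ.1 hδ.2)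
  have hle := meshCount_mono hδ.1 h hE'
  refine div_le_div_of_nonneg_right ?_ hlog.le
  rcases Nat.eq_zero_or_pos (meshCount d δ E) with h0 | h0
  · rw [h0, Nat.cast_zero, Real.log_zero]
    exact Real.log_natCast_nonneg _
  · exact Real.log_le_log (by exact_mod_cast h0) (by exact_mod_cast hle)

theorem exists_meshCount_le_of_upperBoxDim_lt {E : Set (Fin d → ℝ)} (hE : Bornology.IsBounded E)
    {t : ℝ} (ht : upperBoxDim d E < t) :
    ∃ ε > 0, ∀ δ ∈ Set.Ioo (0 : ℝ) ε, (meshCount d δ E : ℝ) ≤ δ ^ (-t) := by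
  have hev := (eventually_lt_of_limsup_lt ht (isBoundedUnder_log_meshCount_div hE)).and
    (eventually_mem_Ioo_nhdsGT one_pos)
  obtain ⟨ε, hε, h⟩ := mem_nhdsGT_iff_exists_Ioo_subset.1 hev
  refine ⟨ε, hε, fun δ hδ => ?_⟩
  obtain ⟨h1, h2⟩ := h hδ
  have hlog : 0 < -Real.log δ := neg_pos.2 (Real.log_neg h2.1 h2.2)
  rcases Nat.eq_zero_or_pos (meshCount d δ E) with h0 | h0
  · rw [h0, Nat.cast_zero]
    exact Real.rpow_nonneg h2.1.le _
  · rw [← Real.log_le_log_iff (by exact_mod_cast h0) (Real.rpow_pos_of_pos h2.1 _),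
      Real.log_rpow h2.1]
    have := (div_lt_iff₀ hlog).1 h1
    linarith

end UpperBoxDim

section EuclDist

variable {d : ℕ}

theorem euclDist_nonneg (x y : Fin d → ℝ) : 0 ≤ euclDist d x y := Real.sqrt_nonneg _

theorem abs_sub_le_euclDist (x y : Fin d → ℝ) (i : Fin d) : |x i - y i| ≤ euclDist d x y := by
  refine Real.abs_le_sqrt ?_
  exact Finset.single_le_sum (f := fun i => (x i - y i) ^ 2) (fun i _ => sq_nonneg _)
    (Finset.mem_univ i)

theorem euclDist_le_of_abs_sub_le {x y : Fin d → ℝ} {δ : ℝ} (hδ : 0 ≤ δ)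
    (h : ∀ i, |x i - y i| ≤ δ) : euclDist d x y ≤ (d + 1) * δ := by
  refine Real.sqrt_le_iff.2 ⟨by positivity, ?_⟩
  have hsum : ∑ i, (x i - y i) ^ 2 ≤ d * δ ^ 2 := by
    refine (Finset.sum_le_card_nsmul _ _ (δ ^ 2) fun i _ => ?_).trans_eq (by simp)
    exact sq_le_sq.2 ((h i).trans (le_abs_self δ))
  have hd : (0 : ℝ) ≤ d := d.cast_nonneg
  nlinarith [mul_nonneg hd (sq_nonneg δ), mul_nonneg (mul_nonneg hd hd) (sq_nonneg δ),
    sq_nonneg δ]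

theorem dist_le_euclDist (x y : Fin d → ℝ) : dist x y ≤ euclDist d x y :=
  (dist_pi_le_iff (euclDist_nonneg x y)).2 fun i => abs_sub_le_euclDist x y i

end EuclDist

section Covers

variable {d : ℕ}

/-- `E` is covered by at most `N` closed Euclidean balls of radius `δ`. -/
def HasCover (E : Set (Fin d → ℝ)) (δ N : ℝ) : Prop :=
  ∃ F : Finset (Fin d → ℝ), (F.card : ℝ) ≤ N ∧ ∀ x ∈ E, ∃ y ∈ F, euclDist d x y ≤ δ

theorem HasCover.mono {E E' : Set (Fin d → ℝ)} {δ δ' N N' : ℝ} (h : HasCover E δ N)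
    (hE : E' ⊆ E) (hδ : δ ≤ δ') (hN : N ≤ N') : HasCover E' δ' N' := by
  obtain ⟨F, hF, hc⟩ := h
  refine ⟨F, hF.trans hN, fun x hx => ?_⟩
  obtain ⟨y, hy, hxy⟩ := hc x (hE hx)
  exact ⟨y, hy, hxy.trans hδ⟩

theorem HasCover.union {E E' : Set (Fin d → ℝ)} {δ N N' : ℝ} (h : HasCover E δ N)
    (h' : HasCover E' δ N') : HasCover (E ∪ E') δ (N + N') := by
  classical
  obtain ⟨F, hF, hc⟩ := h
  obtain ⟨F', hF', hc'⟩ := h'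
  refine ⟨F ∪ F', ?_, ?_⟩
  · have : ((F ∪ F').card : ℝ) ≤ F.card + F'.card := by exact_mod_cast Finset.card_union_le F F'
    linarith
  · rintro x (hx | hx)
    · obtain ⟨y, hy, hxy⟩ := hc x hx
      exact ⟨y, Finset.mem_union_left _ hy, hxy⟩
    · obtain ⟨y, hy, hxy⟩ := hc' x hx
      exact ⟨y, Finset.mem_union_right _ hy, hxy⟩

theorem hasCover_empty (δ : ℝ) : HasCover (∅ : Set (Fin d → ℝ)) δ 0 :=
  ⟨∅, by simp, by simp⟩

theorem HasCover.biUnion {ι : Type*} (s : Finset ι) {E : ι → Set (Fin d → ℝ)} {δ : ℝ} {N : ι → ℝ}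
    (h : ∀ i ∈ s, HasCover (E i) δ (N i)) : HasCover (⋃ i ∈ s, E i) δ (∑ i ∈ s, N i) := by
  classical
  induction s using Finset.induction_on with
  | empty => simpa using hasCover_empty δ
  | insert i s hi ih =>
    rw [Finset.sum_insert hi, Finset.set_biUnion_insert]
    exact (h i (Finset.mem_insert_self i s)).union
      (ih fun j hj => h j (Finset.mem_insert_of_mem hj))

theorem HasCover.image {E : Set (Fin d → ℝ)} {δ N a : ℝ} (h : HasCover E δ N) (ha : 0 ≤ a)
    {f : (Fin d → ℝ) → Fin d → ℝ} (hf : ∀ x y, euclDist d (f x) (f y) = a * euclDist d x y) :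
    HasCover (f '' E) (a * δ) N := by
  classical
  obtain ⟨F, hF, hc⟩ := h
  refine ⟨F.image f, le_trans (by exact_mod_cast Finset.card_image_le) hF, ?_⟩
  rintro _ ⟨x, hx, rfl⟩
  obtain ⟨y, hy, hxy⟩ := hc x hx
  refine ⟨f y, Finset.mem_image_of_mem f hy, ?_⟩
  rw [hf]
  gcongr

theorem hasCover_meshCount {E : Set (Fin d → ℝ)} (hE : Bornology.IsBounded E) {δ : ℝ}
    (hδ : 0 < δ) : HasCover E ((d + 1) * δ) (meshCount d δ E) := by
  classical
  obtain ⟨T, -, hbij⟩ := Set.exists_subset_bijOn E (meshIndex δ)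
  have hinj := hbij.injOn
  have hT := hbij.image_eq
  have hfin : T.Finite := by
    refine Set.Finite.of_finite_image ?_ hinj
    rw [hT]
    exact finite_meshIndex_image hδ hE
  refine ⟨hfin.toFinset, ?_, fun x hx => ?_⟩
  · rw [meshCount_eq_ncard_image hδ, ← hT, hinj.ncard_image, Set.ncard_eq_toFinset_card T hfin]
  · obtain ⟨y, hy, hxy⟩ : meshIndex δ x ∈ meshIndex δ '' T := hT ▸ Set.mem_image_of_mem _ hx
    refine ⟨y, hfin.mem_toFinset.2 hy, euclDist_le_of_abs_sub_le hδ.le fun i => ?_⟩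
    have h := (Int.abs_sub_lt_one_of_floor_eq_floor (congrFun hxy i)).le
    rw [abs_sub_comm, ← sub_div, abs_div, abs_of_pos hδ, div_le_one hδ] at h
    exact h

theorem HasCover.meshCount_le {E : Set (Fin d → ℝ)} {δ N : ℝ} (hδ : 0 < δ) (h : HasCover E δ N) :
    (meshCount d δ E : ℝ) ≤ N * 4 ^ d := by
  obtain ⟨F, hF, hc⟩ := h
  have hball (y : Fin d → ℝ) := finite_meshIndex_image_and_ncard_le hδ hδ.le y
    (E := {x | euclDist d x y ≤ δ}) fun x hx i => (abs_sub_le_euclDist x y i).trans hx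
  have hsub : meshIndex δ '' E ⊆ ⋃ y ∈ F, meshIndex δ '' {x | euclDist d x y ≤ δ} := by
    rintro _ ⟨x, hx, rfl⟩
    obtain ⟨y, hy, hxy⟩ := hc x hx
    exact Set.mem_biUnion hy (Set.mem_image_of_mem _ hxy)
  rw [meshCount_eq_ncard_image hδ]
  calc ((meshIndex δ '' E).ncard : ℝ)
      ≤ (⋃ y ∈ F, meshIndex δ '' {x | euclDist d x y ≤ δ}).ncard := by
        exact_mod_cast Set.ncard_le_ncard hsub
          (F.finite_toSet.biUnion fun y _ => (hball y).1)
    _ ≤ ∑ y ∈ F, ((meshIndex δ '' {x | euclDist d x y ≤ δ}).ncard : ℝ) := by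
        exact_mod_cast Finset.set_ncard_biUnion_le F _
    _ ≤ F.card • (4 : ℝ) ^ d := Finset.sum_le_card_nsmul _ _ _ fun y _ => by
        refine (hball y).2.trans_eq ?_
        rw [mul_div_cancel_right₀ _ hδ.ne']
        norm_num
    _ ≤ N * 4 ^ d := by
        rw [nsmul_eq_mul]
        gcongr

/-- `E` is covered by `O(δ^{-t})` Euclidean balls of radius `δ`, for `δ ∈ (0, 1]`. -/
def HasCoverGrowth (t : ℝ) (E : Set (Fin d → ℝ)) : Prop :=
  ∃ K : ℝ, ∀ δ ∈ Set.Ioc (0 : ℝ) 1, HasCover E δ (K * δ ^ (-t))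

theorem HasCoverGrowth.upperBoxDim_le {E : Set (Fin d → ℝ)} {t : ℝ} (ht : 0 ≤ t)
    (h : HasCoverGrowth t E) : upperBoxDim d E ≤ t := by
  obtain ⟨K, hK⟩ := h
  refine upperBoxDim_le_of_meshCount_le (le_max_right (K * 4 ^ d) 1) ht fun δ hδ => ?_
  refine ((hK δ hδ).meshCount_le hδ.1).trans ?_
  have := Real.rpow_nonneg hδ.1.le (-t)
  rw [mul_right_comm]
  gcongr
  exact le_max_left _ _

theorem hasCoverGrowth_of_upperBoxDim_lt {E : Set (Fin d → ℝ)} (hE : Bornology.IsBounded E)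
    {t : ℝ} (ht : upperBoxDim d E < t) : HasCoverGrowth t E := by
  obtain ⟨ε, hε, h⟩ := exists_meshCount_le_of_upperBoxDim_lt hE ht
  set η : ℝ := min (ε / 2) 1 / (d + 1) with hη
  have hd : (0 : ℝ) < d + 1 := by positivity
  have hη0 : 0 < η := by positivity
  have hη1 : (d + 1) * η ≤ 1 := by
    rw [hη, mul_div_cancel₀ _ hd.ne']
    exact min_le_right _ _
  have hηε : η < ε := by
    have h1 : η ≤ min (ε / 2) 1 := div_le_self (by positivity) (by simp)
    linarith [min_le_left (ε / 2) 1]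
  refine ⟨η ^ (-t), fun δ hδ => ?_⟩
  have hδ0 := hδ.1
  have hmem : η * δ ∈ Set.Ioo 0 ε := by
    refine ⟨by positivity, ?_⟩
    nlinarith [hδ.2]
  refine (hasCover_meshCount hE hmem.1).mono subset_rfl ?_ ?_
  · nlinarith
  · rw [← Real.mul_rpow hη0.le hδ0.le]
    exact h _ hmem

theorem HasCoverGrowth.union {t : ℝ} {E E' : Set (Fin d → ℝ)} (h : HasCoverGrowth t E)
    (h' : HasCoverGrowth t E') : HasCoverGrowth t (E ∪ E') := by
  obtain ⟨K, hK⟩ := h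
  obtain ⟨K', hK'⟩ := h'
  refine ⟨K + K', fun δ hδ => ?_⟩
  rw [add_mul]
  exact (hK δ hδ).union (hK' δ hδ)

theorem HasCoverGrowth.iUnion {ι : Type*} [Fintype ι] {t : ℝ} {E : ι → Set (Fin d → ℝ)}
    (h : ∀ i, HasCoverGrowth t (E i)) : HasCoverGrowth t (⋃ i, E i) := by
  choose K hK using h
  refine ⟨∑ i, K i, fun δ hδ => ?_⟩
  rw [Finset.sum_mul]
  simpa using HasCover.biUnion Finset.univ fun i _ => hK i δ hδ

theorem HasCoverGrowth.image {t : ℝ} {E : Set (Fin d → ℝ)} (h : HasCoverGrowth t E) {a : ℝ}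
    (ha : 0 ≤ a) (ha1 : a ≤ 1) {f : (Fin d → ℝ) → Fin d → ℝ}
    (hf : ∀ x y, euclDist d (f x) (f y) = a * euclDist d x y) : HasCoverGrowth t (f '' E) := by
  obtain ⟨K, hK⟩ := h
  exact ⟨K, fun δ hδ => ((hK δ hδ).image ha hf).mono subset_rfl
    (mul_le_of_le_one_left hδ.1.le ha1) le_rfl⟩

theorem Finset.exists_uniform_mem_Ioo {ι : Type*} (s : Finset ι) {a : ι → ℝ}
    (ha : ∀ i ∈ s, a i ∈ Set.Ioo (0 : ℝ) 1) :
    ∃ ε ∈ Set.Ioo (0 : ℝ) 1, ∀ i ∈ s, ε ≤ a i ∧ a i ≤ 1 - ε := by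
  classical
  induction s using Finset.induction_on with
  | empty => exact ⟨1 / 2, by norm_num, by simp⟩
  | insert i s hi ih =>
    obtain ⟨ε, hε, h⟩ := ih fun j hj => ha j (Finset.mem_insert_of_mem hj)
    obtain ⟨h0, h1⟩ := ha i (Finset.mem_insert_self i s)
    have hε0 := hε.1
    have m1 := min_le_left ε (min (a i) (1 - a i))
    have m2 := min_le_right ε (min (a i) (1 - a i))
    have m3 := min_le_left (a i) (1 - a i)
    have m4 := min_le_right (a i) (1 - a i)
    refine ⟨min ε (min (a i) (1 - a i)),
      ⟨lt_min hε.1 (lt_min h0 (by linarith)), m1.trans_lt hε.2⟩, fun j hj => ?_⟩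
    rcases Finset.mem_insert.1 hj with rfl | hj
    · constructor <;> linarith
    · have := h j hj
      constructor <;> linarith

/-- If `E` lies in the union of a set `D` and finitely many contracted copies of itself, where the
contraction ratios satisfy `∑ aᵢ^t < 1`, then covering growth of order `t` passes from `D` to
`E`. -/
theorem HasCoverGrowth.of_subset_iUnion_image_union {ι : Type*} (s : Finset ι)
    {f : ι → (Fin d → ℝ) → Fin d → ℝ} {a : ι → ℝ} (ha : ∀ i ∈ s, a i ∈ Set.Ioo (0 : ℝ) 1)
    (hf : ∀ i ∈ s, ∀ x y, euclDist d (f i x) (f i y) = a i * euclDist d x y)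
    {E D : Set (Fin d → ℝ)} (hE : Bornology.IsBounded E) (hED : E ⊆ (⋃ i ∈ s, f i '' E) ∪ D)
    {t : ℝ} (ht : 0 ≤ t) (hsum : ∑ i ∈ s, a i ^ t < 1) (hD : HasCoverGrowth t D) :
    HasCoverGrowth t E := by
  obtain ⟨K, hK⟩ := hD
  obtain ⟨b, ⟨hb0, hb1⟩, hb⟩ := s.exists_uniform_mem_Ioo ha
  set p : ℝ := ∑ i ∈ s, a i ^ t with hp
  have hd : (0 : ℝ) < d + 1 := by positivity
  set L₀ : ℝ := (meshCount d (b / (d + 1)) E : ℝ)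
  have hbase : HasCover E b L₀ := by
    have := hasCover_meshCount hE (div_pos hb0 hd)
    rwa [mul_div_cancel₀ _ hd.ne'] at this
  set L : ℝ := max L₀ (K / (1 - p)) with hL
  have hL0 : 0 ≤ L := (Nat.cast_nonneg (meshCount d (b / (d + 1)) E)).trans (le_max_left L₀ _)
  have hLp : L * p + K ≤ L := by
    have := (div_le_iff₀ (sub_pos.2 hsum)).1 (le_max_right L₀ (K / (1 - p)))
    rw [← hL] at this
    linarith
  have hlarge (δ : ℝ) (h1 : δ ≤ 1) (hbδ : b ≤ δ) : HasCover E δ (L * δ ^ (-t)) := by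
    refine hbase.mono subset_rfl hbδ ?_
    have h1 : 1 ≤ δ ^ (-t) :=
      Real.one_le_rpow_of_pos_of_le_one_of_nonpos (hb0.trans_le hbδ) h1 (by linarith)
    exact (le_max_left _ _).trans (le_mul_of_one_le_right hL0 h1)
  have key (k : ℕ) : ∀ δ, 0 < δ → δ ≤ 1 → (1 - b) ^ k * b ≤ δ → HasCover E δ (L * δ ^ (-t)) := by
    induction k with
    | zero => exact fun δ _ h1 hbδ => hlarge δ h1 (by simpa using hbδ)
    | succ k ih =>
      intro δ h0 h1 hk
      rcases le_or_gt b δ with hbδ | hbδ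
      · exact hlarge δ h1 hbδ
      have hpieces : ∀ i ∈ s, HasCover (f i '' E) δ (L * (a i ^ t * δ ^ (-t))) := by
        intro i hi
        have hai := (ha i hi).1
        have hcov := ih (δ / a i) (by positivity)
          ((div_le_one hai).2 (hbδ.le.trans (hb i hi).1)) (by
            rw [le_div_iff₀ hai]
            calc (1 - b) ^ k * b * a i ≤ (1 - b) ^ k * b * (1 - b) := by
                  have : 0 ≤ (1 - b) ^ k := pow_nonneg (by linarith) k
                  gcongr
                  exact (hb i hi).2
              _ = (1 - b) ^ (k + 1) * b := by ring
              _ ≤ δ := hk)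
        refine (hcov.image hai.le (hf i hi)).mono subset_rfl
          (mul_div_cancel₀ δ hai.ne').le (le_of_eq ?_)
        rw [Real.div_rpow h0.le hai.le, Real.rpow_neg hai.le, div_inv_eq_mul, mul_comm (δ ^ (-t))]
      refine ((HasCover.biUnion s hpieces).union (hK δ ⟨h0, h1⟩)).mono hED le_rfl ?_
      have hδt := Real.rpow_nonneg h0.le (-t)
      rw [← Finset.mul_sum, ← Finset.sum_mul, ← hp]
      calc L * (p * δ ^ (-t)) + K * δ ^ (-t) = (L * p + K) * δ ^ (-t) := by ring
        _ ≤ L * δ ^ (-t) := by gcongr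
  refine ⟨L, fun δ hδ => ?_⟩
  obtain ⟨k, hk⟩ := exists_pow_lt_of_lt_one hδ.1 (show 1 - b < 1 by linarith)
  refine key k δ hδ.1 hδ.2 (le_trans ?_ hk.le)
  exact mul_le_of_le_one_right (pow_nonneg (by linarith) k) hb1.le

end Covers

section Words

variable {m : ℕ} {X : Type*}

theorem wordS_append (S : Fin m → X → X) (I J : List (Fin m)) :
    wordS S (I ++ J) = wordS S I ∘ wordS S J := by
  induction I with
  | nil => rfl
  | cons i I ih => exact congrArg (S i ∘ ·) ih

theorem wordS_image_subset {S : Fin m → X → X} {E : Set X} (hE : ∀ i, S i '' E ⊆ E)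
    (I : List (Fin m)) : wordS S I '' E ⊆ E := by
  induction I with
  | nil => exact (Set.image_id E).subset
  | cons i I ih =>
    change (S i ∘ wordS S I) '' E ⊆ E
    rw [Set.image_comp]
    exact (Set.image_mono ih).trans (hE i)

theorem wordC_pos {c : Fin m → ℝ} (hc : ∀ i, 0 < c i) (I : List (Fin m)) : 0 < wordC c I := by
  refine List.prod_pos fun x hx => ?_
  obtain ⟨i, -, rfl⟩ := List.mem_map.1 hx
  exact hc i

theorem wordC_le_pow_length {c : Fin m → ℝ} {ρ : ℝ} (hc : ∀ i, 0 < c i ∧ c i ≤ ρ)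
    (I : List (Fin m)) : wordC c I ≤ ρ ^ I.length := by
  induction I with
  | nil => simp [wordC]
  | cons i I ih =>
    have hρ : 0 ≤ ρ := (hc i).1.le.trans (hc i).2
    have hI := wordC_pos (fun i => (hc i).1) I
    change c i * wordC c I ≤ ρ ^ (I.length + 1)
    rw [pow_succ']
    exact mul_le_mul (hc i).2 ih hI.le hρ

theorem euclDist_wordS {d : ℕ} {S : Fin m → (Fin d → ℝ) → Fin d → ℝ} {c : Fin m → ℝ}
    (hsim : ∀ i x y, euclDist d (S i x) (S i y) = c i * euclDist d x y) (I : List (Fin m))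
    (x y : Fin d → ℝ) :
    euclDist d (wordS S I x) (wordS S I y) = wordC c I * euclDist d x y := by
  induction I with
  | nil => simp [wordS, wordC]
  | cons i I ih =>
    change euclDist d (S i (wordS S I x)) (S i (wordS S I y)) = c i * wordC c I * euclDist d x y
    rw [hsim, ih, mul_assoc]

theorem exists_prefix_mem_stopWords {c : Fin m → ℝ} {r : ℝ} (hr : r < 1) (I : List (Fin m))
    (hI : wordC c I ≤ r) : ∃ J ∈ stopWords c r, J <+: I := by
  induction I using List.reverseRecOn with
  | nil => exact absurd hI (by simpa [wordC] using hr)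
  | append_singleton I i ih =>
    rcases le_or_gt (wordC c I) r with h | h
    · obtain ⟨J, hJ, hJI⟩ := ih h
      exact ⟨J, hJ, hJI.trans (List.prefix_append _ _)⟩
    · exact ⟨I ++ [i], ⟨by simp, hI, by simpa using h⟩, List.prefix_rfl⟩

/-- The part `⋃_{|I| < k} S_I(C)` of the orbit of `C` coming from words of length less than `k`. -/
def partialOrbit (S : Fin m → X → X) (C : Set X) : ℕ → Set X
  | 0 => ∅
  | k + 1 => (⋃ i, S i '' partialOrbit S C k) ∪ C

theorem mem_partialOrbit_or_exists_word {S : Fin m → X → X} {C E : Set X}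
    (hE : E ⊆ (⋃ i, S i '' E) ∪ C) (k : ℕ) :
    ∀ x ∈ E, x ∈ partialOrbit S C k ∨ ∃ I : List (Fin m), I.length = k ∧ x ∈ wordS S I '' E := by
  induction k with
  | zero => exact fun x hx => Or.inr ⟨[], rfl, x, hx, rfl⟩
  | succ k ih =>
    intro x hx
    rcases hE hx with h | h
    · obtain ⟨i, y, hy, rfl⟩ := Set.mem_iUnion.1 h
      rcases ih y hy with hy | ⟨I, hI, z, hz, rfl⟩
      · exact Or.inl (Or.inl (Set.mem_iUnion.2 ⟨i, y, hy, rfl⟩))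
      · exact Or.inr ⟨i :: I, by simp [hI], z, hz, rfl⟩
    · exact Or.inl (Or.inr h)

theorem hasCoverGrowth_partialOrbit {d : ℕ} {S : Fin m → (Fin d → ℝ) → Fin d → ℝ} {c : Fin m → ℝ}
    (hc : ∀ i, 0 < c i ∧ c i < 1)
    (hsim : ∀ i x y, euclDist d (S i x) (S i y) = c i * euclDist d x y) {C : Set (Fin d → ℝ)}
    {t : ℝ} (hC : HasCoverGrowth t C) (k : ℕ) : HasCoverGrowth t (partialOrbit S C k) := by
  induction k with
  | zero => exact ⟨0, fun δ _ => by
      rw [zero_mul]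
      exact hasCover_empty δ⟩
  | succ k ih =>
    exact (HasCoverGrowth.iUnion fun i => ih.image (hc i).1.le (hc i).2.le (hsim i)).union hC

theorem exists_uniform_ratio {c : Fin m → ℝ} (hc : ∀ i, 0 < c i ∧ c i < 1) :
    ∃ ρ ∈ Set.Ioo (0 : ℝ) 1, ∀ i, 0 < c i ∧ c i ≤ ρ := by
  obtain ⟨ε, hε, h⟩ := Finset.univ.exists_uniform_mem_Ioo (a := c) fun i _ => hc i
  exact ⟨1 - ε, ⟨by linarith [hε.2], by linarith [hε.1]⟩,
    fun i => ⟨(hc i).1, (h i (Finset.mem_univ i)).2⟩⟩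

/-- A set covered by its images under the IFS lies in every closed nonempty set that the IFS maps
into itself. -/
theorem subset_of_subset_iUnion_image {d : ℕ} {S : Fin m → (Fin d → ℝ) → Fin d → ℝ}
    {c : Fin m → ℝ} (hc : ∀ i, 0 < c i ∧ c i < 1)
    (hsim : ∀ i x y, euclDist d (S i x) (S i y) = c i * euclDist d x y) {F G : Set (Fin d → ℝ)}
    (hF : Bornology.IsBounded F) (hFS : F ⊆ ⋃ i, S i '' F) (hG : IsClosed G) (hGne : G.Nonempty)
    (hGS : ∀ i, S i '' G ⊆ G) : F ⊆ G := by
  intro x hx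
  obtain ⟨z, hz⟩ := hGne
  obtain ⟨ρ, hρ, hcρ⟩ := exists_uniform_ratio hc
  obtain ⟨M, hM, hFM⟩ :=
    exists_abs_le_of_isBounded (hF.union (Bornology.isBounded_singleton (x := z)))
  set B : ℝ := (d + 1) * (2 * M)
  have hdist : ∀ y ∈ F, euclDist d y z ≤ B := fun y hy =>
    euclDist_le_of_abs_sub_le (by positivity) fun i => by
      have h1 := hFM y (Or.inl hy) i
      have h2 := hFM z (Or.inr rfl) i
      linarith [abs_sub (y i) (z i)]
  have hlim : Tendsto (fun k : ℕ => ρ ^ k * B) atTop (𝓝 0) := by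
    simpa using (tendsto_pow_atTop_nhds_zero_of_lt_one hρ.1.le hρ.2).mul_const B
  rw [← hG.closure_eq, Metric.mem_closure_iff]
  intro ε hε
  obtain ⟨k, hk⟩ := (hlim.eventually (gt_mem_nhds hε)).exists
  rcases mem_partialOrbit_or_exists_word (C := ∅) (by simpa using hFS) k x hx with h | h
  · exfalso
    have hempty : ∀ k, partialOrbit S ∅ k = ∅ := by
      intro k
      induction k with
      | zero => rfl
      | succ k ih => simp [partialOrbit, ih]
    simp [hempty] at h
  · obtain ⟨I, hI, y, hy, rfl⟩ := h
    refine ⟨wordS S I z, wordS_image_subset hGS I ⟨z, hz, rfl⟩, ?_⟩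
    refine (dist_le_euclDist _ _).trans_lt (lt_of_le_of_lt ?_ hk)
    rw [euclDist_wordS hsim, ← hI]
    exact mul_le_mul (wordC_le_pow_length hcρ I) (hdist y hy) (euclDist_nonneg _ _)
      (pow_nonneg hρ.1.le _)

/-- Representatives `R` of the words stopped at a fixed level `r` already bound the upper box
dimension of the inhomogeneous attractor. -/
theorem upperBoxDim_le_max_of_representatives {d : ℕ} {S : Fin m → (Fin d → ℝ) → Fin d → ℝ}
    {c : Fin m → ℝ} (hc : ∀ i, 0 < c i ∧ c i < 1)
    (hsim : ∀ i x y, euclDist d (S i x) (S i y) = c i * euclDist d x y) {C E : Set (Fin d → ℝ)}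
    (hC : Bornology.IsBounded C) (hE : Bornology.IsBounded E) (hEC : E = (⋃ i, S i '' E) ∪ C)
    {r α : ℝ} (hr : r < 1) (hr0 : 0 < r) (R : Finset (List (Fin m)))
    (hR : ∀ I ∈ R, I ∈ stopWords c r)
    (hrep : ∀ J ∈ stopWords c r, ∃ I ∈ R, wordS S I = wordS S J) (hα : 0 ≤ α)
    (hsum : ∑ I ∈ R, wordC c I ^ α = 1) :
    upperBoxDim d E ≤ max α (upperBoxDim d C) := by
  refine le_of_forall_gt_imp_ge_of_dense fun t ht => ?_
  obtain ⟨hαt, hCt⟩ := max_lt_iff.1 ht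
  have ht0 : 0 ≤ t := hα.trans hαt.le
  have hmem : ∀ I ∈ R, wordC c I ∈ Set.Ioo (0 : ℝ) 1 := fun I hI =>
    ⟨wordC_pos (fun i => (hc i).1) I, (hR I hI).2.1.trans_lt hr⟩
  have hRne : R.Nonempty := by
    rw [Finset.nonempty_iff_ne_empty]
    rintro rfl
    simp at hsum
  have hlt : ∑ I ∈ R, wordC c I ^ t < 1 := by
    rw [← hsum]
    exact Finset.sum_lt_sum_of_nonempty hRne fun I hI =>
      Real.rpow_lt_rpow_of_exponent_gt (hmem I hI).1 (hmem I hI).2 hαt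
  obtain ⟨ρ, hρ, hcρ⟩ := exists_uniform_ratio hc
  obtain ⟨k, hk⟩ := exists_pow_lt_of_lt_one hr0 hρ.2
  have hES : ∀ i, S i '' E ⊆ E := fun i => by
    conv_rhs => rw [hEC]
    exact (Set.subset_iUnion (fun i => S i '' E) i).trans Set.subset_union_left
  refine HasCoverGrowth.upperBoxDim_le ht0
    (HasCoverGrowth.of_subset_iUnion_image_union R hmem (fun I _ => euclDist_wordS hsim I) hE ?_
      ht0 hlt
      (hasCoverGrowth_partialOrbit hc hsim (hasCoverGrowth_of_upperBoxDim_lt hC hCt) k))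
  intro x hx
  rcases mem_partialOrbit_or_exists_word hEC.subset k x hx with h | ⟨I, hI, y, hy, rfl⟩
  · exact Or.inr h
  · obtain ⟨J, hJ, J', rfl⟩ := exists_prefix_mem_stopWords hr I
      ((wordC_le_pow_length hcρ I).trans (hI ▸ hk.le))
    obtain ⟨I', hI', heq⟩ := hrep J hJ
    refine Or.inl (Set.mem_biUnion hI' ?_)
    rw [wordS_append, heq]
    exact ⟨wordS S J' y, wordS_image_subset hES J' ⟨y, hy, rfl⟩, rfl⟩

end Words

/-- Theorem 6.1: for an inhomogeneous self-similar set `F_C ⊆ ℝ^n`,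
`max{dim_B F_∅, dim_B C} ≤ dim_B F_C ≤ max{s*, dim_B C}`, where `s*` is the modified
similarity dimension: `s* = inf_{r ∈ (0,1)} α(r)` and `α(r)` is the unique solution of
`Σ_{I ∈ I(r)/∼} c_I^{α(r)} = 1`, the sum ranging over a set `R r` of representatives of
the equivalence classes of `I(r)` under `I ∼ J ⟺ S_I = S_J`. -/
theorem inhomogeneous_bounds_modified (n m : ℕ) (hm : 0 < m)
    (S : Fin m → (Fin n → ℝ) → (Fin n → ℝ)) (c : Fin m → ℝ)
    (hc : ∀ i, 0 < c i ∧ c i < 1)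
    (hsim : ∀ i x y, euclDist n (S i x) (S i y) = c i * euclDist n x y)
    (X : Set (Fin n → ℝ)) (hX : IsCompact X) (hSX : ∀ i, Set.MapsTo (S i) X X)
    (C F₀ FC : Set (Fin n → ℝ)) (hCX : C ⊆ X) (hCcpt : IsCompact C)
    (hF₀ne : F₀.Nonempty) (hF₀cpt : IsCompact F₀) (hF₀ : F₀ = ⋃ i, S i '' F₀)
    (hFCne : FC.Nonempty) (hFCcpt : IsCompact FC) (hFC : FC = (⋃ i, S i '' FC) ∪ C)
    (A : ℝ → ℝ) (R : ℝ → Finset (List (Fin m)))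
    (hR : ∀ r ∈ Set.Ioo (0 : ℝ) 1,
      (∀ I ∈ R r, I ∈ stopWords c r) ∧
      (∀ J ∈ stopWords c r, ∃ I ∈ R r, wordS S I = wordS S J) ∧
      (∀ I ∈ R r, ∀ J ∈ R r, wordS S I = wordS S J → I = J) ∧
      0 ≤ A r ∧ ∑ I ∈ R r, wordC c I ^ A r = 1)
    (sstar : ℝ) (hsstar : sstar = ⨅ r : Set.Ioo (0 : ℝ) 1, A r) :
    max (upperBoxDim n F₀) (upperBoxDim n C) ≤ upperBoxDim n FC ∧
    upperBoxDim n FC ≤ max sstar (upperBoxDim n C) := by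
  have hFCS : ∀ i, S i '' FC ⊆ FC := fun i => by
    conv_rhs => rw [hFC]
    exact (Set.subset_iUnion (fun i => S i '' FC) i).trans Set.subset_union_left
  have hCFC : C ⊆ FC := hFC ▸ Set.subset_union_right
  refine ⟨max_le (upperBoxDim_mono ?_ hFCcpt.isBounded)
    (upperBoxDim_mono hCFC hFCcpt.isBounded), ?_⟩
  · exact subset_of_subset_iUnion_image hc hsim hF₀cpt.isBounded hF₀.subset hFCcpt.isClosed hFCne
      hFCS
  · by_contra! hlt
    obtain ⟨hs, hC⟩ := max_lt_iff.1 hlt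
    rw [hsstar] at hs
    have : Nonempty (Set.Ioo (0 : ℝ) 1) := ⟨⟨1 / 2, by norm_num⟩⟩
    obtain ⟨⟨r, hr⟩, hAr⟩ := exists_lt_of_ciInf_lt hs
    obtain ⟨h1, h2, -, h4, h5⟩ := hR r hr
    exact (upperBoxDim_le_max_of_representatives hc hsim hCcpt.isBounded hFCcpt.isBounded hFC
      hr.2 hr.1 (R r) h1 h2 h4 h5).not_gt (max_lt hAr hC)
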